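/- Let q = 2^m with m ≥ 5 odd. Then (U_{q+1}, B_{σ_{6,3},q+1}), where B_{σ_{6,3},q+1} is the set of 6-subsets B of U_{q+1} with σ_{6,3}(B) = 0, is a 4-(q+1, 6, (q−8)/2) design: every 4-subset of U_{q+1} is contained in exactly (q−8)/2 such 6-subsets. -/

import Mathlib

open Finset

/-- The `l`-th elementary symmetric polynomial evaluated on a finite set `B`. -/
noncomputable def esym {F : Type*} [CommRing F] (B : Finset F) (l : ℕ) : F :=
  ∑ s ∈ B.powersetCard l, ∏ x ∈ s, x

/-- The set of `n`-th roots of unity. -/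
def rootsSet (F : Type*) [Monoid F] (n : ℕ) : Set F := {u | u ^ n = 1}

lemma esym_zero {F : Type*} [CommRing F] (B : Finset F) : esym B 0 = 1 := by
  simp [esym]

lemma esym_empty_succ {F : Type*} [CommRing F] (l : ℕ) : esym (∅ : Finset F) (l + 1) = 0 := by
  rw [esym, Finset.powersetCard_eq_empty.2 (by simp), Finset.sum_empty]

lemma esym_insert_succ {F : Type*} [CommRing F] [DecidableEq F] {B : Finset F} {x : F}
    (hx : x ∉ B) (l : ℕ) : esym (insert x B) (l + 1) = esym B (l + 1) + x * esym B l := by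
  have hmem : ∀ s ∈ B.powersetCard l, x ∉ s := fun s hs h =>
    hx ((Finset.mem_powersetCard.1 hs).1 h)
  have hdisj : Disjoint (B.powersetCard (l + 1)) ((B.powersetCard l).image (insert x)) := by
    rw [Finset.disjoint_left]
    intro s hs hs'
    obtain ⟨t, -, rfl⟩ := Finset.mem_image.1 hs'
    exact hx ((Finset.mem_powersetCard.1 hs).1 (Finset.mem_insert_self x t))
  rw [esym, Finset.powersetCard_succ_insert hx, Finset.sum_union hdisj, Finset.sum_image, esym,
    esym, Finset.mul_sum]
  · congr 1
    exact Finset.sum_congr rfl fun s hs => Finset.prod_insert (hmem s hs)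
  · intro s hs t ht hst
    rw [← Finset.erase_insert (hmem s hs), ← Finset.erase_insert (hmem t ht)]
    exact congrArg (fun u => u.erase x) hst

lemma esym_three_insert_insert {F : Type*} [CommRing F] [DecidableEq F] {E : Finset F} {x y : F}
    (hy : y ∉ E) (hx : x ∉ insert y E) :
    esym (insert x (insert y E)) 3 = x * y * esym E 1 + (x + y) * esym E 2 + esym E 3 := by
  rw [esym_insert_succ hx, esym_insert_succ hy, esym_insert_succ hy]
  ring

/-- An involution of `U` with a single fixed point, which lies outside `E` and which moves `E` off
itself, has exactly `(|U| - 1) / 2 - |E|` two-element orbits disjoint from `E`. -/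
lemma card_image_orbits {α : Type*} [DecidableEq α] {U E : Finset α} {φ : α → α} {r : α}
    (hφU : ∀ x ∈ U, φ x ∈ U) (hφφ : ∀ x ∈ U, φ (φ x) = x) (hrU : r ∈ U)
    (hr : ∀ x ∈ U, φ x = x ↔ x = r) (hEU : E ⊆ U) (hrE : r ∉ E) (hφE : ∀ x ∈ E, φ x ∉ E) :
    2 * (({x ∈ U | x ∉ E ∧ φ x ∉ E ∧ x ≠ r}).image fun x => insert x (insert (φ x) E)).card
      + 2 * E.card + 1 = U.card := by
  set W := {x ∈ U | x ∉ E ∧ φ x ∉ E ∧ x ≠ r} with hW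
  have hinj : Set.InjOn φ U := fun x hx y hy h => by
    rw [← hφφ x hx, ← hφφ y hy, h]
  have hdisj : Disjoint E (E.image φ) := by
    rw [Finset.disjoint_left]
    intro x hx hx'
    obtain ⟨y, hy, rfl⟩ := Finset.mem_image.1 hx'
    exact hφE y hy hx
  have hrU' : φ r = r := (hr r hrU).2 rfl
  have hrEE : r ∉ E ∪ E.image φ := by
    rw [Finset.mem_union, Finset.mem_image]
    rintro (h | ⟨y, hy, h⟩)
    · exact hrE h
    · exact hrE (hinj (hEU hy) hrU (h.trans hrU'.symm) ▸ hy)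
  have hWU : W = U \ insert r (E ∪ E.image φ) := by
    ext x
    simp only [hW, Finset.mem_filter, Finset.mem_sdiff, Finset.mem_insert, Finset.mem_union,
      Finset.mem_image, not_or, not_exists, not_and]
    constructor
    · rintro ⟨hx, hxE, hφx, hxr⟩
      exact ⟨hx, hxr, hxE, fun y hy h => hφx (by rw [← h, hφφ y (hEU hy)]; exact hy)⟩
    · rintro ⟨hx, hxr, hxE, h⟩
      exact ⟨hx, hxE, fun h' => h _ h' (hφφ x hx), hxr⟩
  have hsub : insert r (E ∪ E.image φ) ⊆ U := by
    refine Finset.insert_subset hrU (Finset.union_subset hEU ?_)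
    intro x hx
    obtain ⟨y, hy, rfl⟩ := Finset.mem_image.1 hx
    exact hφU y (hEU hy)
  have hcard : W.card + (2 * E.card + 1) = U.card := by
    rw [← Finset.card_sdiff_add_card_eq_card hsub, ← hWU, Finset.card_insert_of_notMem hrEE,
      Finset.card_union_of_disjoint hdisj,
      Finset.card_image_of_injOn (hinj.mono (by exact_mod_cast hEU))]
    ring
  have hfib : ∀ B ∈ W.image (fun x => insert x (insert (φ x) E)),
      (W.filter fun x => insert x (insert (φ x) E) = B).card = 2 := by
    intro B hB
    obtain ⟨x, hx, rfl⟩ := Finset.mem_image.1 hB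
    obtain ⟨hxU, hxE, hφx, hxr⟩ := Finset.mem_filter.1 hx
    have hne : x ≠ φ x := fun h => hxr ((hr x hxU).1 h.symm)
    have : (W.filter fun y => insert y (insert (φ y) E) = insert x (insert (φ x) E))
        = {x, φ x} := by
      ext y
      simp only [Finset.mem_filter, Finset.mem_insert, Finset.mem_singleton]
      constructor
      · rintro ⟨hy, h⟩
        have hyE := (Finset.mem_filter.1 hy).2.1
        have : y ∈ insert x (insert (φ x) E) := h ▸ Finset.mem_insert_self _ _
        simp only [Finset.mem_insert] at this
        tauto
      · rintro (rfl | rfl)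
        · exact ⟨hx, rfl⟩
        · refine ⟨Finset.mem_filter.2 ⟨hφU x hxU, hφx, by rwa [hφφ x hxU], fun h => hxr ?_⟩, ?_⟩
          · rw [← hφφ x hxU, h, hrU']
          · rw [hφφ x hxU, Finset.insert_comm]
    rw [this, Finset.card_pair hne]
  have := Finset.card_eq_sum_card_image (fun x => insert x (insert (φ x) E)) W
  rw [Finset.sum_congr rfl hfib, Finset.sum_const, smul_eq_mul] at this
  omega

lemma card_filter_pow_eq_one {F : Type*} [Field F] [Fintype F] [DecidableEq F] {q : ℕ}
    (hF : Fintype.card F = q ^ 2) (hq : 1 < q) :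
    (({x : F | x ^ (q + 1) = 1} : Finset F)).card = q + 1 := by
  obtain ⟨g, hg⟩ := IsCyclic.exists_ofOrder_eq_natCard (α := Fˣ)
  have hcard : Nat.card Fˣ = (q - 1) * (q + 1) := by
    rw [Nat.card_eq_fintype_card, Fintype.card_units, hF]
    obtain ⟨k, rfl⟩ : ∃ k, q = k + 1 := ⟨q - 1, by omega⟩
    have : (k + 1) ^ 2 = k * (k + 2) + 1 := by ring
    rw [this]
    simp
  have hprim : IsPrimitiveRoot (g : F) ((q - 1) * (q + 1)) := by
    rw [← hcard, ← hg]
    exact IsPrimitiveRoot.coe_units_iff.2 (IsPrimitiveRoot.orderOf g)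
  have hprim' := hprim.pow (Nat.mul_pos (by omega) (by omega)) rfl
  have : ({x : F | x ^ (q + 1) = 1} : Finset F) = Polynomial.nthRootsFinset (q + 1) (1 : F) := by
    ext x
    simp [Polynomial.mem_nthRootsFinset]
  rw [this, hprim'.card_nthRootsFinset]

section CharTwo

variable {F : Type*} [Field F] [CharP F 2]

/-- A primitive cube root of unity is not fixed by the `m`-th power of Frobenius for odd `m`. -/
lemma sq_add_mul_add_sq_ne_zero {m : ℕ} (hodd : Odd m) {A B e : F} (hA : A ≠ 0) (he : e ≠ 0)
    (hAq : A ^ 2 ^ m * e = A) (hBq : B ^ 2 ^ m * e = B) : A ^ 2 + A * B + B ^ 2 ≠ 0 := by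
  intro h
  have h2 : (2 : F) = 0 := CharTwo.two_eq_zero
  have hB : B ≠ 0 := by
    rintro rfl
    exact hA (by simpa using h)
  obtain ⟨k, rfl⟩ := hodd
  set l := A / B with hl
  have hl1 : l ^ 2 + l + 1 = 0 := by
    rw [hl]; field_simp; linear_combination h
  have hl3 : l ^ 3 = 1 := by linear_combination (l - 1) * hl1
  have hlq : l ^ 2 ^ (2 * k + 1) = l := by
    rw [hl, div_pow]
    have hBq0 : B ^ 2 ^ (2 * k + 1) ≠ 0 := pow_ne_zero _ hB
    rw [div_eq_div_iff hBq0 hB]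
    apply mul_right_cancel₀ he
    linear_combination B * hAq - A * hBq
  have hmod : 2 ^ (2 * k + 1) % 3 = 2 := by
    rw [pow_succ, pow_mul, Nat.mul_mod, Nat.pow_mod]
    norm_num
  have hl2 : l ^ 2 = l := by
    rw [← Nat.div_add_mod (2 ^ (2 * k + 1)) 3, hmod, pow_add, pow_mul, hl3, one_pow, one_mul] at hlq
    exact hlq
  have : (1 : F) = 0 := by linear_combination hl1 - hl2 - l * h2
  exact one_ne_zero this

lemma ncard_blocks [Fintype F] {m : ℕ} (hm : 0 < m) (hodd : Odd m)
    (hF : Fintype.card F = (2 ^ m) ^ 2) (E : Finset F) (hEU : ↑E ⊆ rootsSet F (2 ^ m + 1))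
    (hE : E.card = 4) :
    2 * {B : Finset F | ↑B ⊆ rootsSet F (2 ^ m + 1) ∧ B.card = 6 ∧
      esym B 3 = 0 ∧ E ⊆ B}.ncard + 9 = 2 ^ m + 1 := by
  classical
  have h2 : (2 : F) = 0 := CharTwo.two_eq_zero
  obtain ⟨a, b, c, d, hab, hac, had, hbc, hbd, hcd, hEeq⟩ := Finset.card_eq_four.1 hE
  have haU : a ^ (2 ^ m + 1) = 1 := hEU (by simp [hEeq])
  have hbU : b ^ (2 ^ m + 1) = 1 := hEU (by simp [hEeq])
  have hcU : c ^ (2 ^ m + 1) = 1 := hEU (by simp [hEeq])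
  have hdU : d ^ (2 ^ m + 1) = 1 := hEU (by simp [hEeq])
  have hne0 : ∀ x : F, x ^ (2 ^ m + 1) = 1 → x ≠ 0 := by
    rintro x hx rfl
    simp at hx
  have hinv : ∀ x : F, x ^ (2 ^ m + 1) = 1 → x ^ 2 ^ m = x⁻¹ := fun x hx =>
    eq_inv_of_mul_eq_one_left (by rw [← pow_succ, hx])
  have hadd : ∀ x y : F, (x + y) ^ 2 ^ m = x ^ 2 ^ m + y ^ 2 ^ m := fun x y =>
    add_pow_char_pow x y 2 m
  have ha0 := hne0 a haU
  have hb0 := hne0 b hbU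
  have hc0 := hne0 c hcU
  have hd0 := hne0 d hdU
  have nz : ∀ {x y : F}, x ≠ y → x + y ≠ 0 := fun h h' => h (CharTwo.add_eq_zero.1 h')
  have he1 : esym E 1 = a + b + c + d := by
    rw [hEeq, ← insert_empty_eq d]
    repeat rw [esym_insert_succ (by simp [*])]
    simp only [esym_zero, esym_empty_succ]
    ring
  have he2 : esym E 2 = a * b + a * c + a * d + b * c + b * d + c * d := by
    rw [hEeq, ← insert_empty_eq d]
    repeat rw [esym_insert_succ (by simp [*])]
    simp only [esym_zero, esym_empty_succ]
    ring
  have he3 : esym E 3 = a * b * c + a * b * d + a * c * d + b * c * d := by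
    rw [hEeq, ← insert_empty_eq d]
    repeat rw [esym_insert_succ (by simp [*])]
    simp only [esym_zero, esym_empty_succ]
    ring
  set e1 := esym E 1
  set e2 := esym E 2
  set e3 := esym E 3
  obtain ⟨e4, he4⟩ : ∃ e4, e4 = a * b * c * d := ⟨_, rfl⟩
  have he40 : e4 ≠ 0 := by rw [he4]; simp [*]
  have c1 : e1 ^ 2 ^ m * e4 = e3 := by
    rw [he1, he3, he4]
    simp only [hadd, hinv _ haU, hinv _ hbU, hinv _ hcU, hinv _ hdU]
    field_simp
    ring
  have c2 : e2 ^ 2 ^ m * e4 = e2 := by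
    rw [he2, he4]
    simp only [hadd, mul_pow, hinv _ haU, hinv _ hbU, hinv _ hcU, hinv _ hdU]
    field_simp
    ring
  have c3 : e3 ^ 2 ^ m * e4 = e1 := by
    rw [he1, he3, he4]
    simp only [hadd, mul_pow, hinv _ haU, hinv _ hbU, hinv _ hcU, hinv _ hdU]
    field_simp
    ring
  have hfixE : ∀ x ∈ E, e1 * x ^ 2 + e3 ≠ 0 := by
    intro x hx
    rw [hEeq] at hx
    simp only [Finset.mem_insert, Finset.mem_singleton] at hx
    rcases hx with rfl | rfl | rfl | rfl
    · convert mul_ne_zero (mul_ne_zero (nz hab) (nz hac)) (nz had) using 1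
      grind
    · convert mul_ne_zero (mul_ne_zero (nz hab) (nz hbc)) (nz hbd) using 1
      grind
    · convert mul_ne_zero (mul_ne_zero (nz hac) (nz hbc)) (nz hcd) using 1
      grind
    · convert mul_ne_zero (mul_ne_zero (nz had) (nz hbd)) (nz hcd) using 1
      grind
  have hmoveE : ∀ x ∈ E, ∀ y ∈ E, x * y * e1 + (x + y) * e2 + e3 ≠ 0 := by
    intro x hx y hy
    by_cases hxy : x = y
    · subst hxy
      convert hfixE x hx using 1
      linear_combination x * e2 * h2
    · have key : ∀ {x y z w : F}, x ≠ y → z ≠ w → e1 = x + y + z + w →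
          e2 = x * y + x * z + x * w + y * z + y * w + z * w →
          e3 = x * y * z + x * y * w + x * z * w + y * z * w →
          x * y * e1 + (x + y) * e2 + e3 ≠ 0 := by
        intro x y z w hxy hzw h1 h2' h3
        convert mul_ne_zero (pow_ne_zero 2 (nz hxy)) (nz hzw) using 1
        grind
      rw [hEeq] at hx hy
      simp only [Finset.mem_insert, Finset.mem_singleton] at hx hy
      rcases hx with rfl | rfl | rfl | rfl <;> rcases hy with rfl | rfl | rfl | rfl <;>
        first
        | exact absurd rfl hxy
        | exact key hxy hcd (by linear_combination he1) (by linear_combination he2)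
            (by linear_combination he3)
        | exact key hxy hbd (by linear_combination he1) (by linear_combination he2)
            (by linear_combination he3)
        | exact key hxy hbc (by linear_combination he1) (by linear_combination he2)
            (by linear_combination he3)
        | exact key hxy had (by linear_combination he1) (by linear_combination he2)
            (by linear_combination he3)
        | exact key hxy hac (by linear_combination he1) (by linear_combination he2)
            (by linear_combination he3)
        | exact key hxy hab (by linear_combination he1) (by linear_combination he2)
            (by linear_combination he3)
  have he10 : e1 ≠ 0 := by
    intro h
    have h3 : e3 = 0 := by rw [← c1, h, zero_pow (by positivity), zero_mul]
    exact hfixE a (by simp [hEeq]) (by rw [h, h3]; ring)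
  have hI : e2 ^ 2 + e1 * e3 ≠ 0 := by
    have := sq_add_mul_add_sq_ne_zero hodd (A := (a + b) * (c + d)) (B := (a + c) * (b + d))
      (mul_ne_zero (nz hab) (nz hcd)) he40
      (by
        rw [he4]
        simp only [hadd, mul_pow, hinv _ haU, hinv _ hbU, hinv _ hcU, hinv _ hdU]
        field_simp
        ring)
      (by
        rw [he4]
        simp only [hadd, mul_pow, hinv _ haU, hinv _ hbU, hinv _ hcU, hinv _ hdU]
        field_simp
        ring)
    convert this using 1
    rw [he1, he2, he3]
    linear_combination -((a * d + b * c) ^ 2 - (a * b + c * d) * (a * c + b * d)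
      - 2 * (a * b * c * d)) * h2
  have hden : ∀ x : F, x ^ (2 ^ m + 1) = 1 → e1 * x + e2 ≠ 0 := by
    intro x hx h
    have hx0 := hne0 x hx
    have h' : (e1 * x + e2) ^ 2 ^ m * e4 = 0 := by
      rw [h, zero_pow (by positivity), zero_mul]
    rw [hadd, mul_pow, hinv x hx] at h'
    have h3 : e3 + e2 * x = 0 := by
      have : e3 * x⁻¹ + e2 = 0 := by linear_combination h' - x⁻¹ * c1 - c2
      field_simp at this
      linear_combination this
    exact hI (by linear_combination e1 * h3 + e2 * h - e1 * e2 * x * h2)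
  obtain ⟨φ, hφ⟩ : ∃ φ : F → F, ∀ x, φ x = (e2 * x + e3) / (e1 * x + e2) := ⟨_, fun _ => rfl⟩
  have hrel : ∀ x, x ^ (2 ^ m + 1) = 1 → ∀ y,
      (x * y * e1 + (x + y) * e2 + e3 = 0 ↔ y = φ x) := by
    intro x hx y
    rw [hφ, eq_div_iff (hden x hx)]
    exact ⟨fun h => by linear_combination h - (e2 * x + e3) * h2,
      fun h => by linear_combination h + (e2 * x + e3) * h2⟩
  have hφU : ∀ x, x ^ (2 ^ m + 1) = 1 → φ x ^ (2 ^ m + 1) = 1 := by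
    intro x hx
    have hx0 := hne0 x hx
    have hd1 := hden x hx
    have hd2 : (e1 * x + e2) ^ 2 ^ m ≠ 0 := pow_ne_zero _ hd1
    have hn : (e2 * x + e3) ^ 2 ^ m * e4 * x = e1 * x + e2 := by
      rw [hadd, mul_pow, hinv x hx]
      field_simp
      linear_combination c2 + x * c3
    have hdd : (e1 * x + e2) ^ 2 ^ m * e4 * x = e2 * x + e3 := by
      rw [hadd, mul_pow, hinv x hx]
      field_simp
      linear_combination c1 + x * c2
    rw [hφ, pow_succ, div_pow, div_mul_div_comm, div_eq_one_iff_eq (mul_ne_zero hd2 hd1)]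
    linear_combination (e1 * x + e2) ^ 2 ^ m * hn - (e2 * x + e3) ^ 2 ^ m * hdd
  have hφφ : ∀ x, x ^ (2 ^ m + 1) = 1 → φ (φ x) = x := by
    intro x hx
    have := (hrel x hx (φ x)).2 rfl
    exact ((hrel (φ x) (hφU x hx) x).1 (by linear_combination this)).symm
  obtain ⟨r, hr⟩ := FiniteField.isSquare_of_char_two (ringChar.eq F 2) (e3 / e1)
  have hr' : e1 * r ^ 2 = e3 := by
    rw [pow_two, ← hr]; field_simp
  have sq_inj : ∀ {x y : F}, x ^ 2 = y ^ 2 → x = y := fun h => CharTwo.sq_injective h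
  have hrU : r ^ (2 ^ m + 1) = 1 := by
    apply sq_inj
    have he30 : e3 ≠ 0 := by
      rw [← c1]
      exact mul_ne_zero (pow_ne_zero _ he10) he40
    have hx := congrArg (· ^ (2 ^ m + 1)) hr'
    simp only [mul_pow] at hx
    have he : e3 ^ (2 ^ m + 1) = e1 ^ (2 ^ m + 1) := by
      apply mul_right_cancel₀ he40
      rw [pow_succ, pow_succ]
      linear_combination e3 * c3 - e1 * c1
    rw [he] at hx
    rw [one_pow, ← pow_mul, mul_comm, pow_mul]
    exact mul_left_cancel₀ (pow_ne_zero _ he10) (hx.trans (mul_one _).symm)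
  have hfix : ∀ x, x ^ (2 ^ m + 1) = 1 → (φ x = x ↔ x = r) := by
    intro x hx
    rw [eq_comm, ← hrel x hx]
    constructor
    · intro h
      apply sq_inj
      apply mul_left_cancel₀ he10
      linear_combination h - hr' - (x * e2 + e3) * h2
    · rintro rfl
      linear_combination hr' + (x * e2 + e3) * h2
  set U : Finset F := {x : F | x ^ (2 ^ m + 1) = 1} with hU
  have hmU : ∀ x, x ∈ U ↔ x ^ (2 ^ m + 1) = 1 := by simp [hU]
  have hcount := card_image_orbits (U := U) (E := E) (φ := φ) (r := r)
    (fun x hx => (hmU _).2 (hφU x ((hmU x).1 hx))) (fun x hx => hφφ x ((hmU x).1 hx))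
    ((hmU r).2 hrU) (fun x hx => hfix x ((hmU x).1 hx)) (fun x hx => (hmU x).2 (hEU hx))
    (fun h => hfixE r h (by linear_combination hr' + e3 * h2))
    (fun x hx h => hmoveE x hx (φ x) h ((hrel x (hEU hx) _).2 rfl))
  rw [card_filter_pow_eq_one hF (Nat.one_lt_two_pow hm.ne'), hE] at hcount
  have hset : {B : Finset F | ↑B ⊆ rootsSet F (2 ^ m + 1) ∧ B.card = 6 ∧ esym B 3 = 0 ∧ E ⊆ B}
      = ↑(({x ∈ U | x ∉ E ∧ φ x ∉ E ∧ x ≠ r}).image fun x => insert x (insert (φ x) E)) := by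
    ext B
    simp only [Set.mem_ofPred_eq, Finset.coe_image, Set.mem_image, Finset.mem_coe,
      Finset.mem_filter]
    constructor
    · rintro ⟨hBU, hB6, hB3, hEB⟩
      have hcard : (B \ E).card = 2 := by rw [Finset.card_sdiff_of_subset hEB, hB6, hE]
      obtain ⟨x, y, hxy, hBE⟩ := Finset.card_eq_two.1 hcard
      have hx : x ∈ B \ E := by simp [hBE]
      have hy : y ∈ B \ E := by simp [hBE]
      rw [Finset.mem_sdiff] at hx hy
      have hBeq : B = insert x (insert y E) := by
        rw [← Finset.sdiff_union_of_subset hEB, hBE]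
        ext; simp
      have hxU : x ^ (2 ^ m + 1) = 1 := hBU hx.1
      rw [hBeq, esym_three_insert_insert hy.2 (by simp [hxy, hx.2]), hrel x hxU] at hB3
      refine ⟨x, ⟨(hmU x).2 hxU, hx.2, hB3 ▸ hy.2, fun h => hxy ?_⟩, ?_⟩
      · rw [hB3, (hfix x hxU).2 h]
      · rw [hBeq, hB3]
    · rintro ⟨x, ⟨hxU, hxE, hφx, hxr⟩, rfl⟩
      rw [hmU] at hxU
      have hne : x ≠ φ x := fun h => hxr ((hfix x hxU).1 h.symm)
      have hx : x ∉ insert (φ x) E := by simp [hne, hxE]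
      refine ⟨?_, ?_, ?_, ?_⟩
      · intro z hz
        rw [Finset.mem_coe, Finset.mem_insert, Finset.mem_insert] at hz
        rcases hz with rfl | rfl | hz
        · exact hxU
        · exact hφU x hxU
        · exact hEU hz
      · rw [Finset.card_insert_of_notMem hx, Finset.card_insert_of_notMem hφx, hE]
      · rw [esym_three_insert_insert hφx hx, hrel x hxU]
      · exact (Finset.subset_insert _ _).trans (Finset.subset_insert _ _)
  rw [hset, Set.ncard_coe_finset]
  omega

end CharTwo

theorem stmt8 (m : ℕ) (hm : 5 ≤ m) (hodd : Odd m)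
    (E : Finset (GaloisField 2 (2 * m)))
    (hEU : ↑E ⊆ rootsSet (GaloisField 2 (2 * m)) (2 ^ m + 1))
    (hE : E.card = 4) :
    {B : Finset (GaloisField 2 (2 * m)) |
        ↑B ⊆ rootsSet (GaloisField 2 (2 * m)) (2 ^ m + 1) ∧ B.card = 6 ∧
          esym B 3 = 0 ∧ E ⊆ B}.ncard = (2 ^ m - 8) / 2 := by
  have := Fintype.ofFinite (GaloisField 2 (2 * m))
  have hF : Fintype.card (GaloisField 2 (2 * m)) = (2 ^ m) ^ 2 := by
    rw [← Nat.card_eq_fintype_card, GaloisField.card 2 (2 * m) (by omega), ← pow_mul, mul_comm]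
  have := ncard_blocks (by omega) hodd hF E hEU hE
  omega
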